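/- Let K carry a recurrence structure, let p, p' ∈ Δ(K), and let p = Σ_{n=1}^N α_n p_n be a finite convex combination (α_n ≥ 0, Σ_n α_n = 1, p_n ∈ Δ(K)) such that p_n B = pB for all n. Then there exist p'_1, …, p'_N ∈ Δ(K) such that p'_n B = p'B for all n, p' = Σ_{n=1}^N α_n p'_n, and Σ_{n=1}^N α_n S(p_n, p'_n) = S(p, p'). -/

import Mathlib

/-- The `L¹` distance between two vectors indexed by a finite set. -/
noncomputable def dist1 {S : Type*} [Fintype S] (p p' : S → ℝ) : ℝ :=
  ∑ k, |p k - p' k|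

/-- Row-vector times matrix multiplication, `(p A) k' = ∑ k, p k * A k k'`. -/
noncomputable def vecMulF {K : Type*} [Fintype K] (p : K → ℝ) (A : K → K → ℝ) : K → ℝ :=
  fun k' => ∑ k, p k * A k k'

/-- A recurrence structure on a finite set `K`: a partition of `K` into `R` nonempty
classes (given by the class map `cls`, surjectivity expressing nonemptiness of classes),
together with, for each class `r`, a probability vector `pstar r ∈ Δ(K)` supported
in the class `r`. -/
structure RecStruct (K : Type*) [Fintype K] (R : ℕ) where
  cls : K → Fin R
  cls_surj : Function.Surjective cls
  pstar : Fin R → K → ℝ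
  pstar_mem : ∀ r, pstar r ∈ stdSimplex ℝ K
  pstar_supp : ∀ r k, pstar r k ≠ 0 → cls k = r

namespace RecStruct

variable {K : Type*} [Fintype K] {R : ℕ}

/-- `lam rs p r` is the total mass given by `p` to the recurrence class `r`. -/
noncomputable def lam (rs : RecStruct K R) (p : K → ℝ) : Fin R → ℝ :=
  fun r => ∑ k, if rs.cls k = r then p k else 0

/-- The conditional law of `p` given the recurrence class `r` (equal to `pstar r` when the
class has zero mass under `p`). -/
noncomputable def cond (rs : RecStruct K R) (p : K → ℝ) (r : Fin R) : K → ℝ :=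
  if 0 < rs.lam p r then (fun k => if rs.cls k = r then p k / rs.lam p r else 0)
  else rs.pstar r

/-- The quantity `S(p,p') = ‖λ(p) - λ(p')‖₁ + ∑_{r : λ(p)^r λ(p')^r > 0} λ(p')^r ‖p_{|r} - p'_{|r}‖₁`. -/
noncomputable def Sdist (rs : RecStruct K R) (p p' : K → ℝ) : ℝ :=
  dist1 (rs.lam p) (rs.lam p') +
    ∑ r, if 0 < rs.lam p r * rs.lam p' r
      then rs.lam p' r * dist1 (rs.cond p r) (rs.cond p' r) else 0

/-- The projection matrix `B`, whose row `k` is `pstar r` where `r` is the class of `k`. -/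
noncomputable def Bmat (rs : RecStruct K R) : K → K → ℝ :=
  fun k k' => rs.pstar (rs.cls k) k'

/-- `P*`, the convex hull of the invariant measures of the classes. -/
noncomputable def Pset (rs : RecStruct K R) : Set (K → ℝ) :=
  convexHull ℝ (Set.range rs.pstar)

/-- `B^{-1}(p*) = {p ∈ Δ(K) : pB = p*}`. -/
def Binv (rs : RecStruct K R) (pst : K → ℝ) : Set (K → ℝ) :=
  {p | p ∈ stdSimplex ℝ K ∧ vecMulF p rs.Bmat = pst}

/-- A stochastic matrix on `K` compatible with the recurrence structure: it is block
diagonal with respect to the partition and each `pstar r` is invariant. -/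
structure IsCompatible (rs : RecStruct K R) (M : K → K → ℝ) : Prop where
  nonneg : ∀ k k', 0 ≤ M k k'
  rowSum : ∀ k, ∑ k', M k k' = 1
  block : ∀ k k', rs.cls k ≠ rs.cls k' → M k k' = 0
  invariant : ∀ r, vecMulF (rs.pstar r) M = rs.pstar r

end RecStruct

/-- Optimal transport of a convex decomposition: if `u = ∑ α n • u n` and all the `u n` have the same
total mass as `w` on `s`, then `w` decomposes as `∑ α n • w n` with the same masses, such that the
distances `|u n k - w n k|` average to `|u k - w k|` in each coordinate. -/
theorem exists_decomposition_abs_sub_eq {K ι : Type*} [Fintype ι] (s : Finset K)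
    (α : ι → ℝ) (u w : K → ℝ) (un : ι → K → ℝ) (b : ℝ)
    (hw : ∀ k ∈ s, 0 ≤ w k) (hun : ∀ n, ∀ k ∈ s, 0 ≤ un n k)
    (husum : ∑ k ∈ s, u k = b) (hwsum : ∑ k ∈ s, w k = b) (hunsum : ∀ n, ∑ k ∈ s, un n k = b)
    (hdecomp : ∀ k ∈ s, ∑ n, α n * un n k = u k) :
    ∃ wn : ι → K → ℝ, (∀ n, ∀ k ∈ s, 0 ≤ wn n k) ∧ (∀ n, ∑ k ∈ s, wn n k = b) ∧
      (∀ k ∈ s, ∑ n, α n * wn n k = w k) ∧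
      ∀ k ∈ s, ∑ n, α n * |un n k - wn n k| = |u k - w k| := by
  -- `t k` is the proportion of mass kept at `k`, `e k` the mass to be received there
  let t : K → ℝ := fun k => if u k ≤ w k then 1 else w k / u k
  let e : K → ℝ := fun k => if u k ≤ w k then w k - u k else 0
  let D : ℝ := ∑ k ∈ s, e k
  let d : ι → ℝ := fun n => ∑ k ∈ s, un n k * (1 - t k)
  have ht0 : ∀ k ∈ s, 0 ≤ t k := by
    intro k hk
    by_cases h : u k ≤ w k
    · simp [t, h]
    · simp only [t, h, if_false]
      exact div_nonneg (hw k hk) ((hw k hk).trans (not_le.mp h).le)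
  have ht1 : ∀ k ∈ s, t k ≤ 1 := by
    intro k hk
    by_cases h : u k ≤ w k
    · simp [t, h]
    · simp only [t, h, if_false]
      exact div_le_one_of_le₀ (not_le.mp h).le ((hw k hk).trans (not_le.mp h).le)
  have he : ∀ k, 0 ≤ e k := by
    intro k
    by_cases h : u k ≤ w k <;> simp [e, h]
  have hsplit : ∀ k ∈ s, u k * t k + e k = w k := by
    intro k hk
    by_cases h : u k ≤ w k
    · simp [t, e, h]
    · have : u k ≠ 0 := ((hw k hk).trans_lt (not_le.mp h)).ne'
      simp only [t, e, h, if_false]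
      field_simp
      ring
  have hd : ∀ n, 0 ≤ d n := fun n => Finset.sum_nonneg fun k hk =>
    mul_nonneg (hun n k hk) (sub_nonneg.mpr (ht1 k hk))
  have hD : 0 ≤ D := Finset.sum_nonneg fun k _ => he k
  have hdD : ∑ n, α n * d n = D := by
    have h1 : ∑ n, α n * d n = ∑ k ∈ s, u k * (1 - t k) := by
      simp only [d, Finset.mul_sum]
      rw [Finset.sum_comm]
      refine Finset.sum_congr rfl fun k hk => ?_
      rw [← hdecomp k hk, Finset.sum_mul]
      exact Finset.sum_congr rfl fun n _ => by ring
    have h2 : ∑ k ∈ s, u k * (1 - t k) - D = ∑ k ∈ s, u k - ∑ k ∈ s, w k := by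
      simp only [D]
      rw [← Finset.sum_sub_distrib, ← Finset.sum_sub_distrib]
      refine Finset.sum_congr rfl fun k hk => ?_
      linarith [hsplit k hk]
    linarith
  have hD0 : D = 0 → ∀ k ∈ s, e k = 0 ∧ t k = 1 := by
    intro h
    have hez : ∀ k ∈ s, e k = 0 := (Finset.sum_eq_zero_iff_of_nonneg fun k _ => he k).mp h
    have hwu : ∀ k ∈ s, w k ≤ u k := by
      intro k hk
      by_cases hle : u k ≤ w k
      · have := hez k hk
        simp only [e, hle, if_true] at this
        linarith
      · exact (not_le.mp hle).le
    have heq := (Finset.sum_eq_sum_iff_of_le hwu).mp (hwsum.trans husum.symm)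
    exact fun k hk => ⟨hez k hk, by simp [t, heq k hk]⟩
  have hdd : ∀ n, D * (d n / D) = d n := by
    intro n
    by_cases h : D = 0
    · have : d n = 0 := Finset.sum_eq_zero fun k hk => by rw [(hD0 h k hk).2]; ring
      simp [h, this]
    · field_simp
  have hemul : ∀ k ∈ s, e k * (D / D) = e k := by
    intro k hk
    by_cases h : D = 0
    · simp [(hD0 h k hk).1]
    · field_simp
  let wn : ι → K → ℝ := fun n k => un n k * t k + e k * (d n / D)
  have hsum : ∀ k ∈ s, ∑ n, α n * wn n k = w k := by
    intro k hk
    calc ∑ n, α n * wn n k = (∑ n, α n * un n k) * t k + e k * ((∑ n, α n * d n) / D) := by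
          rw [Finset.sum_mul, Finset.sum_div, Finset.mul_sum, ← Finset.sum_add_distrib]
          exact Finset.sum_congr rfl fun n _ => by simp only [wn]; ring
      _ = w k := by rw [hdecomp k hk, hdD, hemul k hk, hsplit k hk]
  refine ⟨wn, ?_, ?_, hsum, ?_⟩
  · intro n k hk
    exact add_nonneg (mul_nonneg (hun n k hk) (ht0 k hk))
      (mul_nonneg (he k) (div_nonneg (hd n) hD))
  · intro n
    have h1 : ∑ k ∈ s, wn n k = ∑ k ∈ s, un n k * t k + D * (d n / D) := by
      simp only [wn, D]
      rw [Finset.sum_add_distrib, Finset.sum_mul]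
    have h2 : ∑ k ∈ s, un n k * t k + d n = ∑ k ∈ s, un n k := by
      simp only [d]
      rw [← Finset.sum_add_distrib]
      exact Finset.sum_congr rfl fun k _ => by ring
    rw [h1, hdd, h2, hunsum]
  · intro k hk
    have hdiff : ∑ n, α n * (un n k - wn n k) = u k - w k := by
      simp only [mul_sub, Finset.sum_sub_distrib]
      rw [hsum k hk, hdecomp k hk]
    by_cases h : u k ≤ w k
    · rw [abs_of_nonpos (sub_nonpos.mpr h), ← hdiff, ← Finset.sum_neg_distrib]
      refine Finset.sum_congr rfl fun n _ => ?_
      have hle : un n k - wn n k ≤ 0 := by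
        have := mul_nonneg (he k) (div_nonneg (hd n) hD)
        have htk : t k = 1 := by simp [t, h]
        simp only [wn, htk]
        linarith
      rw [abs_of_nonpos hle]
      ring
    · rw [abs_of_pos (sub_pos.mpr (not_le.mp h)), ← hdiff]
      refine Finset.sum_congr rfl fun n _ => ?_
      have hge : 0 ≤ un n k - wn n k := by
        have hek : e k = 0 := by simp [e, h]
        have := mul_nonneg (hun n k hk) (sub_nonneg.mpr (ht1 k hk))
        simp only [wn, hek]
        linarith
      rw [abs_of_nonneg hge]

namespace RecStruct

variable {K : Type*} [Fintype K] {R : ℕ}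

theorem lam_eq_sum_filter (rs : RecStruct K R) (p : K → ℝ) (r : Fin R) :
    rs.lam p r = ∑ k with rs.cls k = r, p k := by
  rw [lam, Finset.sum_filter]

theorem vecMulF_Bmat_apply (rs : RecStruct K R) (p : K → ℝ) (k' : K) :
    vecMulF p rs.Bmat k' = ∑ r, rs.lam p r * rs.pstar r k' := by
  simp only [vecMulF, Bmat, lam, Finset.sum_mul]
  rw [Finset.sum_comm]
  refine Finset.sum_congr rfl fun k _ => ?_
  simp [ite_mul]

theorem vecMulF_Bmat_congr (rs : RecStruct K R) {p q : K → ℝ} (h : rs.lam p = rs.lam q) :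
    vecMulF p rs.Bmat = vecMulF q rs.Bmat := by
  funext k
  rw [vecMulF_Bmat_apply, vecMulF_Bmat_apply, h]

theorem lam_vecMulF_Bmat (rs : RecStruct K R) (p : K → ℝ) :
    rs.lam (vecMulF p rs.Bmat) = rs.lam p := by
  funext r
  have hmass : ∀ r', rs.lam (rs.pstar r') r = if r' = r then 1 else 0 := by
    intro r'
    by_cases h : r' = r
    · subst h
      rw [if_pos rfl, ← (rs.pstar_mem r').2]
      refine Finset.sum_congr rfl fun k _ => ?_
      by_cases hk : rs.cls k = r'
      · simp [hk]
      · rw [if_neg hk]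
        by_contra hne
        exact hk (rs.pstar_supp r' k (Ne.symm hne))
    · rw [if_neg h]
      refine Finset.sum_eq_zero fun k _ => ?_
      by_cases hk : rs.cls k = r
      · rw [if_pos hk]
        by_contra hne
        exact h ((rs.pstar_supp r' k hne).symm.trans hk)
      · simp [hk]
  calc rs.lam (vecMulF p rs.Bmat) r = ∑ r', rs.lam p r' * rs.lam (rs.pstar r') r := by
        simp only [lam_eq_sum_filter, vecMulF_Bmat_apply, Finset.mul_sum]
        rw [Finset.sum_comm]
    _ = rs.lam p r := by simp [hmass]

theorem lam_eq_of_vecMulF_Bmat_eq (rs : RecStruct K R) {p q : K → ℝ}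
    (h : vecMulF p rs.Bmat = vecMulF q rs.Bmat) : rs.lam p = rs.lam q := by
  rw [← lam_vecMulF_Bmat rs p, h, lam_vecMulF_Bmat]

theorem lam_nonneg (rs : RecStruct K R) {p : K → ℝ} (hp : ∀ k, 0 ≤ p k) (r : Fin R) :
    0 ≤ rs.lam p r := by
  rw [lam_eq_sum_filter]
  exact Finset.sum_nonneg fun k _ => hp k

theorem sum_lam (rs : RecStruct K R) (p : K → ℝ) : ∑ r, rs.lam p r = ∑ k, p k := by
  simp only [lam]
  rw [Finset.sum_comm]
  simp

/-- An expression for `Sdist` on nonnegative vectors that does not use conditional laws. -/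
theorem Sdist_eq (rs : RecStruct K R) {p q : K → ℝ} (hp : ∀ k, 0 ≤ p k) (hq : ∀ k, 0 ≤ q k) :
    rs.Sdist p q = dist1 (rs.lam p) (rs.lam q) +
      ∑ r, if 0 < rs.lam p r * rs.lam q r
        then ∑ k with rs.cls k = r, |p k * (rs.lam q r / rs.lam p r) - q k| else 0 := by
  rw [Sdist]
  congr 1
  refine Finset.sum_congr rfl fun r _ => ?_
  by_cases h : 0 < rs.lam p r * rs.lam q r
  · have ha : 0 < rs.lam p r := pos_of_mul_pos_left h (rs.lam_nonneg hq r)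
    have hb : 0 < rs.lam q r := pos_of_mul_pos_right h (rs.lam_nonneg hp r)
    rw [if_pos h, if_pos h, dist1, Finset.mul_sum, Finset.sum_filter]
    refine Finset.sum_congr rfl fun k _ => ?_
    simp only [cond, ha, hb, if_true]
    by_cases hk : rs.cls k = r
    · simp only [hk, if_true]
      rw [← abs_of_pos hb, ← abs_mul, abs_of_pos hb]
      congr 1
      field_simp
    · simp [hk]
  · rw [if_neg h, if_neg h]

end RecStruct

/-- **Lemma `setvaluedmapH`.** Let `p, p' ∈ Δ(K)` and let `p = ∑_{n} α_n p_n` be a finite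
convex combination with `p_n B = pB` for all `n`. Then there exist `p'_1, …, p'_N ∈ Δ(K)`
with `p'_n B = p'B` for all `n`, `p' = ∑_n α_n p'_n`, and
`∑_n α_n S(p_n, p'_n) = S(p, p')`. -/
theorem H_nonexpansive_Sdist {K : Type*} [Fintype K] {R : ℕ}
    (rs : RecStruct K R) (p p' : K → ℝ)
    (hp : p ∈ stdSimplex ℝ K) (hp' : p' ∈ stdSimplex ℝ K)
    (N : ℕ) (α : Fin N → ℝ) (pn : Fin N → K → ℝ)
    (hα : ∀ n, 0 ≤ α n) (hαsum : ∑ n, α n = 1)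
    (hpn : ∀ n, pn n ∈ stdSimplex ℝ K)
    (hdecomp : ∑ n, α n • pn n = p)
    (hB : ∀ n, vecMulF (pn n) rs.Bmat = vecMulF p rs.Bmat) :
    ∃ pn' : Fin N → K → ℝ,
      (∀ n, pn' n ∈ stdSimplex ℝ K) ∧
      (∀ n, vecMulF (pn' n) rs.Bmat = vecMulF p' rs.Bmat) ∧
      (∑ n, α n • pn' n = p') ∧
      ∑ n, α n * rs.Sdist (pn n) (pn' n) = rs.Sdist p p' := by
  have hlam : ∀ n, rs.lam (pn n) = rs.lam p := fun n => rs.lam_eq_of_vecMulF_Bmat_eq (hB n)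
  have hpk : ∀ k, ∑ n, α n * pn n k = p k := by
    intro k
    rw [← hdecomp]
    simp
  have key : ∀ r, ∃ wn : Fin N → K → ℝ, (∀ n k, rs.cls k = r → 0 ≤ wn n k) ∧
      (∀ n, ∑ k with rs.cls k = r, wn n k = rs.lam p' r) ∧
      (∀ k, rs.cls k = r → ∑ n, α n * wn n k = p' k) ∧
      (0 < rs.lam p r * rs.lam p' r → ∀ k, rs.cls k = r →
        ∑ n, α n * |pn n k * (rs.lam p' r / rs.lam p r) - wn n k| =
          |p k * (rs.lam p' r / rs.lam p r) - p' k|) := by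
    intro r
    by_cases h : 0 < rs.lam p r * rs.lam p' r
    · have ha : 0 < rs.lam p r := pos_of_mul_pos_left h (rs.lam_nonneg hp'.1 r)
      have hc : 0 ≤ rs.lam p' r / rs.lam p r := div_nonneg (rs.lam_nonneg hp'.1 r) ha.le
      obtain ⟨wn, h1, h2, h3, h4⟩ := exists_decomposition_abs_sub_eq
        (Finset.univ.filter fun k => rs.cls k = r) α
        (fun k => p k * (rs.lam p' r / rs.lam p r)) p'
        (fun n k => pn n k * (rs.lam p' r / rs.lam p r)) (rs.lam p' r)
        (fun k _ => hp'.1 k) (fun n k _ => mul_nonneg ((hpn n).1 k) hc)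
        (by rw [← Finset.sum_mul, ← rs.lam_eq_sum_filter]; field_simp)
        (rs.lam_eq_sum_filter p' r).symm
        (fun n => by
          rw [← Finset.sum_mul, ← rs.lam_eq_sum_filter, hlam n]; field_simp)
        (fun k _ => by
          rw [← hpk k, Finset.sum_mul]
          exact Finset.sum_congr rfl fun n _ => by ring)
      exact ⟨wn, fun n k hk => h1 n k (by simpa using hk), h2,
        fun k hk => h3 k (by simpa using hk), fun _ k hk => h4 k (by simpa using hk)⟩
    · exact ⟨fun _ => p', fun _ k _ => hp'.1 k, fun _ => (rs.lam_eq_sum_filter p' r).symm,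
        fun k _ => by rw [← Finset.sum_mul, hαsum, one_mul], fun h' => absurd h' h⟩
  choose w hw0 hwsum hwdecomp hwdist using key
  have hnonneg : ∀ n k, 0 ≤ w (rs.cls k) n k := fun n k => hw0 _ n k rfl
  have hlam' : ∀ n, rs.lam (fun k => w (rs.cls k) n k) = rs.lam p' := by
    intro n
    funext r
    rw [rs.lam_eq_sum_filter, ← hwsum r n]
    refine Finset.sum_congr rfl fun k hk => ?_
    rw [(Finset.mem_filter.mp hk).2]
  refine ⟨fun n k => w (rs.cls k) n k, fun n => ⟨hnonneg n, ?_⟩,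
    fun n => rs.vecMulF_Bmat_congr (hlam' n), ?_, ?_⟩
  · rw [← rs.sum_lam, hlam', rs.sum_lam, hp'.2]
  · funext k
    simpa using hwdecomp (rs.cls k) k rfl
  · simp only [rs.Sdist_eq hp.1 hp'.1, rs.Sdist_eq (hpn _).1 (hnonneg _), hlam, hlam', mul_add,
      Finset.sum_add_distrib, Finset.mul_sum]
    rw [← Finset.sum_mul, hαsum, one_mul, Finset.sum_comm]
    congr 1
    refine Finset.sum_congr rfl fun r _ => ?_
    by_cases h : 0 < rs.lam p r * rs.lam p' r
    · simp only [h, if_true, Finset.mul_sum]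
      rw [Finset.sum_comm]
      refine Finset.sum_congr rfl fun k hk => ?_
      have hk := (Finset.mem_filter.mp hk).2
      rw [← hwdist r h k hk, hk]
    · simp [h]
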